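/- arXiv:1812.00600 — 4 statements merged into one kernel-verified Lean document; each statement's English description precedes it below -/
import Mathlib

section
/- Let n ≥ 2, let Ĉ_1, …, Ĉ_n ∈ (0, 1] with S := Σ_{i=1}^n Ĉ_i > 1, and define ε_k = Ĉ_k·(n−1)/(S−1) − 1 for each k. Assume ε_k ≥ 0 for all k. Then for every y ∈ [0,1]^n with Σ_{i=1}^n (y_i + ε_i) > 0, the constrained-softmax output z_k(y) = (y_k + ε_k) / Σ_{i=1}^n (y_i + ε_i) satisfies 0 ≤ z_k(y) ≤ Ĉ_k for every k, and Σ_{k=1}^n z_k(y) = 1. -/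
open Finset

/-- Proposition 1 of the paper: the constrained softmax with maximum bounds
`Cmax k ∈ (0,1]` (whose sum `S` exceeds 1) and shifts
`ε k = Cmax k * (n-1)/(S-1) - 1 ≥ 0` produces, for every `y ∈ [0,1]^n` with
positive denominator, outputs `z k = (y k + ε k) / ∑ i (y i + ε i)` satisfying
`0 ≤ z k ≤ Cmax k` and `∑ k z k = 1`. -/
theorem constrained_softmax_satisfies_bounds
    {n : ℕ} (hn : 2 ≤ n) (Cmax : Fin n → ℝ)
    (hC : ∀ i, 0 < Cmax i ∧ Cmax i ≤ 1)
    (hS : 1 < ∑ i, Cmax i)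
    (ε : Fin n → ℝ)
    (hεdef : ∀ k, ε k = Cmax k * ((n : ℝ) - 1) / ((∑ i, Cmax i) - 1) - 1)
    (hεnonneg : ∀ k, 0 ≤ ε k)
    (y : Fin n → ℝ) (hy : ∀ i, 0 ≤ y i ∧ y i ≤ 1)
    (hpos : 0 < ∑ i, (y i + ε i)) :
    (∀ k, 0 ≤ (y k + ε k) / (∑ i, (y i + ε i)) ∧
      (y k + ε k) / (∑ i, (y i + ε i)) ≤ Cmax k) ∧
    (∑ k, (y k + ε k) / (∑ i, (y i + ε i))) = 1 := by
  have hS' : (∑ i, Cmax i) - 1 ≠ 0 := (sub_pos.mpr hS).ne'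
  set a : ℝ := ((n : ℝ) - 1) / ((∑ i, Cmax i) - 1) with ha
  have hε : ∀ k, ε k = Cmax k * a - 1 := fun k => by rw [hεdef k, ha, mul_div_assoc]
  have hεsum : ∑ i, ε i = a - 1 := by
    have haS : a * ((∑ i, Cmax i) - 1) = n - 1 := div_mul_cancel₀ _ hS'
    simp only [hε, sum_sub_distrib, ← sum_mul, sum_const, card_univ, Fintype.card_fin,
      nsmul_eq_mul, mul_one]
    linarith
  refine ⟨fun k => ⟨div_nonneg (add_nonneg (hy k).1 (hεnonneg k)) hpos.le, ?_⟩, ?_⟩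
  · have hyk : y k ≤ ∑ i, y i := single_le_sum (fun i _ => (hy i).1) (mem_univ k)
    rw [div_le_iff₀ hpos, sum_add_distrib, hεsum, hε k]
    have h₁ := mul_le_mul_of_nonneg_left hyk (hC k).1.le
    have h₂ := mul_nonneg (sub_nonneg.mpr (hy k).2) (sub_nonneg.mpr (hC k).2)
    linarith
  · rw [← sum_div, div_self hpos.ne']
end

section
/- Let n ≥ 2 and let Č_1, …, Č_n, Ĉ_1, …, Ĉ_n be real numbers with 0 ≤ Č_k < Ĉ_k for all k, Σ_j Č_j < 1 < Σ_j Ĉ_j. Define B_k = (Ĉ_k − Č_k)/(1 − Σ_j Č_j) and S' = Σ_k B_k (so S' > 1), and define ε'_k = B_k·(n−1)/(S'−1) − 1; assume ε'_k ≥ 0 for all k. Then for every y ∈ [0,1]^n with Σ_i (y_i + ε'_i) > 0, the vector z defined by z_k = Č_k + (1 − Σ_j Č_j)·(y_k + ε'_k)/Σ_i (y_i + ε'_i) satisfies Č_k ≤ z_k ≤ Ĉ_k for all k and Σ_k z_k = 1. -/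
open Finset

/-- Nonnegativity of all the shifts `B k * c - 1`, with `c = (n - 1) / (∑ i, B i - 1)`, forces
every bound `B k` to be at most one: sum the inequalities `1 ≤ B j * c` over `j ≠ k`. -/
lemma bound_le_one_of_shift_nonneg {n : ℕ} (B : Fin n → ℝ) (c : ℝ) (hc : 0 < c)
    (hcB : c * ((∑ i, B i) - 1) = (n : ℝ) - 1) (hshift : ∀ k, 0 ≤ B k * c - 1) (k : Fin n) :
    B k ≤ 1 := by
  have hrest : 0 ≤ ∑ i ∈ univ.erase k, (B i * c - 1) := sum_nonneg fun i _ => hshift i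
  have hsplit := add_sum_erase univ (fun i => B i * c - 1) (mem_univ k)
  have htotal : ∑ i, (B i * c - 1) = (∑ i, B i) * c - n := by
    simp [sum_sub_distrib, sum_mul]
  have hscaled : c * B k ≤ c * 1 := by linarith
  exact le_of_mul_le_mul_left hscaled hc

/-- The numerator of the shifted softmax is at most `B k` times its denominator. -/
lemma shifted_le_bound_mul_sum {n : ℕ} (B : Fin n → ℝ) (c : ℝ) (hc : 0 < c)
    (hcB : c * ((∑ i, B i) - 1) = (n : ℝ) - 1) (hshift : ∀ k, 0 ≤ B k * c - 1)
    (y : Fin n → ℝ) (hy : ∀ i, 0 ≤ y i ∧ y i ≤ 1) (k : Fin n) :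
    y k + (B k * c - 1) ≤ B k * ∑ i, (y i + (B i * c - 1)) := by
  have hB1 := bound_le_one_of_shift_nonneg B c hc hcB hshift k
  have hB0 : 0 ≤ B k := (pos_of_mul_pos_left (by linarith [hshift k]) hc.le).le
  have hyk : y k ≤ ∑ i, y i := single_le_sum (fun i _ => (hy i).1) (mem_univ k)
  have hsum : ∑ i, (y i + (B i * c - 1)) = (∑ i, y i) + c - 1 := by
    have : ∑ i, (y i + (B i * c - 1)) = (∑ i, y i) + ((∑ i, B i) * c - n) := by
      simp [sum_add_distrib, sum_sub_distrib, sum_mul]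
    linarith
  rw [hsum]
  nlinarith [mul_nonneg hB0 (sub_nonneg.2 hyk),
    mul_nonneg (sub_nonneg.2 hB1) (sub_nonneg.2 (hy k).2)]

/-- The full constrained-softmax layer: combining the shifted softmax over the
rescaled maximum bounds `B k = (Cmax k - Cmin k)/(1 - ∑ j Cmin j)` (with shifts
`ε' k = B k * (n-1)/(S'-1) - 1 ≥ 0`, `S' = ∑ k B k`) with the affine re-shift
`z k = Cmin k + (1 - ∑ j Cmin j) * (y k + ε' k)/∑ i (y i + ε' i)` yields outputs
satisfying `Cmin k ≤ z k ≤ Cmax k` and `∑ k z k = 1`. -/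
theorem full_constrained_softmax_satisfies_bounds
    {n : ℕ} (hn : 2 ≤ n) (Cmin Cmax : Fin n → ℝ)
    (hb : ∀ k, 0 ≤ Cmin k ∧ Cmin k < Cmax k)
    (hlo : (∑ j, Cmin j) < 1) (hhi : 1 < ∑ j, Cmax j)
    (B : Fin n → ℝ)
    (hB : ∀ k, B k = (Cmax k - Cmin k) / (1 - ∑ j, Cmin j))
    (ε' : Fin n → ℝ)
    (hε' : ∀ k, ε' k = B k * ((n : ℝ) - 1) / ((∑ i, B i) - 1) - 1)
    (hεnonneg : ∀ k, 0 ≤ ε' k)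
    (y : Fin n → ℝ) (hy : ∀ i, 0 ≤ y i ∧ y i ≤ 1)
    (hpos : 0 < ∑ i, (y i + ε' i))
    (z : Fin n → ℝ)
    (hz : ∀ k, z k = Cmin k +
      (1 - ∑ j, Cmin j) * ((y k + ε' k) / ∑ i, (y i + ε' i))) :
    (∀ k, Cmin k ≤ z k ∧ z k ≤ Cmax k) ∧ (∑ k, z k) = 1 := by
  have hd : 0 < 1 - ∑ j, Cmin j := by linarith
  have hn1 : (0 : ℝ) < (n : ℝ) - 1 := by
    have : (2 : ℝ) ≤ n := by exact_mod_cast hn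
    linarith
  have hS : 0 < (∑ i, B i) - 1 := by
    have hsum : ∑ i, B i = ((∑ j, Cmax j) - ∑ j, Cmin j) / (1 - ∑ j, Cmin j) := by
      simp [hB, ← sum_div, sum_sub_distrib]
    rw [hsum, sub_pos, one_lt_div hd]
    linarith
  have hε : ε' = fun k => B k * (((n : ℝ) - 1) / ((∑ i, B i) - 1)) - 1 := by
    funext k
    rw [hε', mul_div_assoc]
  have hdB (k : Fin n) : (1 - ∑ j, Cmin j) * B k = Cmax k - Cmin k := by
    rw [hB, mul_div_cancel₀ _ hd.ne']
  refine ⟨fun k => ⟨?_, ?_⟩, ?_⟩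
  · rw [hz]
    have := mul_nonneg hd.le (div_nonneg (add_nonneg (hy k).1 (hεnonneg k)) hpos.le)
    linarith
  · have hsoftmax : (y k + ε' k) / ∑ i, (y i + ε' i) ≤ B k := by
      rw [div_le_iff₀ hpos]
      subst hε
      exact shifted_le_bound_mul_sum B _ (div_pos hn1 hS) (div_mul_cancel₀ _ hS.ne') hεnonneg y hy k
    rw [hz]
    linarith [mul_le_mul_of_nonneg_left hsoftmax hd.le, hdB k]
  · simp_rw [hz]
    rw [sum_add_distrib, ← mul_sum, ← sum_div, div_self hpos.ne']
    ring
end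

section
/- Let Ω be a nonempty finite index set, and for k ∈ Ω let Č_k, y_k be reals with Č_k ≤ y_k. Let C' be a real with Σ_{k∈Ω} Č_k < C' ≤ Σ_{k∈Ω} y_k, and define z_k = y_k + (C' − Σ_{j∈Ω} y_j)/|Ω| for k ∈ Ω. Let Ω' = {k ∈ Ω : z_k < Č_k}, assume Ω' is nonempty, and set C'' = C' − Σ_{k∈Ω'} Č_k. Then Ω' ⊊ Ω, and the remaining subproblem is still feasible for the LOWER phase: Σ_{k∈Ω∖Ω'} Č_k < C'' and C'' < Σ_{k∈Ω∖Ω'} y_k (hence also C'' < Σ_{k∈Ω∖Ω'} Ĉ_k whenever y_k ≤ Ĉ_k for all k). -/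
open Finset

/-- Step 2 of the correctness proof of Algorithm 1 (feasibility invariant of
the LOWER phase): after one redistribution-and-clamp iteration the clamped set
`Ω'` is a proper subset of `Ω`, and the remaining subproblem stays feasible:
`∑_{Ω∖Ω'} Cmin < C''` and `C'' < ∑_{Ω∖Ω'} y` (hence also `C'' < ∑_{Ω∖Ω'} Cmax`
whenever `y ≤ Cmax` componentwise). -/
theorem lower_phase_invariant
    {ι : Type*} [DecidableEq ι] (Ω : Finset ι) (hΩ : Ω.Nonempty)
    (Cmin y : ι → ℝ) (hb : ∀ k ∈ Ω, Cmin k ≤ y k)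
    (C' : ℝ) (h1 : (∑ k ∈ Ω, Cmin k) < C') (h2 : C' ≤ ∑ k ∈ Ω, y k)
    (z : ι → ℝ)
    (hz : ∀ k ∈ Ω, z k = y k + (C' - ∑ j ∈ Ω, y j) / (Ω.card : ℝ))
    (Ω' : Finset ι) (hΩ' : Ω' = Ω.filter (fun k => z k < Cmin k))
    (hne : Ω'.Nonempty)
    (C'' : ℝ) (hC'' : C'' = C' - ∑ k ∈ Ω', Cmin k) :
    Ω' ⊂ Ω ∧
    (∑ k ∈ Ω \ Ω', Cmin k) < C'' ∧
    C'' < (∑ k ∈ Ω \ Ω', y k) ∧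
    ∀ Cmax : ι → ℝ, (∀ k ∈ Ω, y k ≤ Cmax k) → C'' < ∑ k ∈ Ω \ Ω', Cmax k := by
  have hcard : (Ω.card : ℝ) ≠ 0 := by exact_mod_cast hΩ.card_pos.ne'
  have hzsum : ∑ k ∈ Ω, z k = C' := by
    rw [sum_congr rfl hz, sum_add_distrib, sum_const, nsmul_eq_mul, mul_div_cancel₀ _ hcard]
    ring
  have hzy : ∀ k ∈ Ω, z k ≤ y k := fun k hk => by
    have : (C' - ∑ j ∈ Ω, y j) / (Ω.card : ℝ) ≤ 0 :=
      div_nonpos_of_nonpos_of_nonneg (sub_nonpos.2 h2) (Nat.cast_nonneg _)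
    linarith [hz k hk]
  have hsub : Ω' ⊆ Ω := hΩ' ▸ filter_subset _ _
  have hclamp : ∑ k ∈ Ω', z k < ∑ k ∈ Ω', Cmin k :=
    sum_lt_sum_of_nonempty hne fun k hk => by
      rw [hΩ'] at hk
      exact (mem_filter.1 hk).2
  have hCmin := sum_sdiff (f := Cmin) hsub
  have hzsplit := sum_sdiff (f := z) hsub
  have hrest : ∑ k ∈ Ω \ Ω', z k ≤ ∑ k ∈ Ω \ Ω', y k :=
    sum_le_sum fun k hk => hzy k (mem_sdiff.1 hk).1
  have hlt : C'' < ∑ k ∈ Ω \ Ω', y k := by linarith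
  refine ⟨hsub.ssubset_of_ne ?_, by linarith, hlt, fun Cmax hmax =>
    hlt.trans_le (sum_le_sum fun k hk => hmax k (mem_sdiff.1 hk).1)⟩
  intro h
  rw [h] at hclamp
  linarith
end

section
/- Let Ω be a nonempty finite index set, and for k ∈ Ω let y_k, Ĉ_k be reals with y_k ≤ Ĉ_k. Let C' be a real with Σ_{k∈Ω} y_k ≤ C' < Σ_{k∈Ω} Ĉ_k, and define z_k = y_k + (C' − Σ_{j∈Ω} y_j)/|Ω| for k ∈ Ω. Let Ω' = {k ∈ Ω : z_k > Ĉ_k}, assume Ω' is nonempty, and set C'' = C' − Σ_{k∈Ω'} Ĉ_k. Then Ω' ⊊ Ω, and the remaining subproblem is still feasible for the UPPER phase: Σ_{k∈Ω∖Ω'} y_k < C'' and C'' < Σ_{k∈Ω∖Ω'} Ĉ_k (hence also Σ_{k∈Ω∖Ω'} Č_k < C'' whenever Č_k ≤ y_k for all k). -/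
open Finset

/-- Step 4 of the correctness proof of Algorithm 1 (feasibility invariant of
the UPPER phase): after one redistribution-and-clamp iteration the clamped set
`Ω'` is a proper subset of `Ω`, and the remaining subproblem stays feasible:
`∑_{Ω∖Ω'} y < C''` and `C'' < ∑_{Ω∖Ω'} Cmax` (hence also
`∑_{Ω∖Ω'} Cmin < C''` whenever `Cmin ≤ y` componentwise). -/
theorem upper_phase_invariant
    {ι : Type*} [DecidableEq ι] (Ω : Finset ι) (hΩ : Ω.Nonempty)
    (y Cmax : ι → ℝ) (hb : ∀ k ∈ Ω, y k ≤ Cmax k)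
    (C' : ℝ) (h1 : (∑ k ∈ Ω, y k) ≤ C') (h2 : C' < ∑ k ∈ Ω, Cmax k)
    (z : ι → ℝ)
    (hz : ∀ k ∈ Ω, z k = y k + (C' - ∑ j ∈ Ω, y j) / (Ω.card : ℝ))
    (Ω' : Finset ι) (hΩ' : Ω' = Ω.filter (fun k => Cmax k < z k))
    (hne : Ω'.Nonempty)
    (C'' : ℝ) (hC'' : C'' = C' - ∑ k ∈ Ω', Cmax k) :
    Ω' ⊂ Ω ∧
    (∑ k ∈ Ω \ Ω', y k) < C'' ∧
    C'' < (∑ k ∈ Ω \ Ω', Cmax k) ∧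
    ∀ Cmin : ι → ℝ, (∀ k ∈ Ω, Cmin k ≤ y k) → (∑ k ∈ Ω \ Ω', Cmin k) < C'' := by
  have hcard : (Ω.card : ℝ) ≠ 0 := Nat.cast_ne_zero.mpr hΩ.card_pos.ne'
  have hsub : Ω' ⊆ Ω := hΩ' ▸ filter_subset _ _
  have hclamp : ∀ k ∈ Ω', Cmax k < z k := fun k hk => by
    rw [hΩ'] at hk
    exact (mem_filter.mp hk).2
  have hzsum : ∑ k ∈ Ω, z k = C' := by
    rw [sum_congr rfl hz, sum_add_distrib, sum_const, nsmul_eq_mul, mul_div_cancel₀ _ hcard]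
    ring
  have hlt : ∑ k ∈ Ω', Cmax k < ∑ k ∈ Ω', z k := sum_lt_sum_of_nonempty hne hclamp
  have hyz : ∑ k ∈ Ω \ Ω', y k ≤ ∑ k ∈ Ω \ Ω', z k := by
    refine sum_le_sum fun k hk => ?_
    rw [hz k (mem_sdiff.mp hk).1]
    exact le_add_of_nonneg_right (div_nonneg (sub_nonneg.mpr h1) (Nat.cast_nonneg _))
  have hzsplit := sum_sdiff (f := z) hsub
  have hCsplit := sum_sdiff (f := Cmax) hsub
  have hy : ∑ k ∈ Ω \ Ω', y k < C'' := by linarith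
  refine ⟨hsub.ssubset_of_ne ?_, hy, by linarith, fun Cmin hmin => ?_⟩
  · rintro rfl
    linarith
  · exact (sum_le_sum fun k hk => hmin k (mem_sdiff.mp hk).1).trans_lt hy
end
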